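/- Let h : ℝ³ → ℍ be a continuous function with compact support and define u(x) = (1/(4π)) ∫_{ℝ³} (q(x − y)/‖x − y‖³) · h(y) dy, where q(v) = v₁ i + v₂ j + v₃ k ∈ ℍ for v ∈ ℝ³ and the product is quaternionic multiplication. Then (∫_{ℝ³} ‖u(x)‖² / (1 + ‖x‖²) dx)^{1/2} ≤ (1/3) · (∫_{ℝ³} ‖h(x)‖² (1 + ‖x‖²) dx)^{1/2}. (This is the case n = 3, k = 1 of the paper's sharp weighted bound for convolution with the Cauchy kernel G₁(x) = x/(ω_n‖x‖ⁿ); here ω₃ = 4π is the surface area of the unit sphere in ℝ³.) -/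

import Mathlib

open Real

noncomputable section

/-- The embedding `q(v) = v₁ i + v₂ j + v₃ k` of `ℝ³` into the imaginary
quaternions. -/
def quatOfR3 (v : EuclideanSpace ℝ (Fin 3)) : Quaternion ℝ := ⟨0, v 0, v 1, v 2⟩

open MeasureTheory Filter Topology

/-- `ℝ³` -/
abbrev E3 := EuclideanSpace ℝ (Fin 3)

/-- Inverse Japanese bracket. -/
def jp (x : E3) : ℝ := (√(1 + ‖x‖ ^ 2))⁻¹

lemma jp_pos (x : E3) : 0 < jp x := by unfold jp; positivity

lemma jp_sq (x : E3) : jp x ^ 2 = (1 + ‖x‖ ^ 2)⁻¹ := by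
  unfold jp; rw [inv_pow, Real.sq_sqrt (by positivity)]

lemma w_jp (x : E3) : (1 + ‖x‖ ^ 2) * jp x ^ 2 = 1 := by
  rw [jp_sq]; exact mul_inv_cancel₀ (by positivity)

lemma jp_le_one (x : E3) : jp x ≤ 1 := by
  have := w_jp x
  have := jp_pos x
  nlinarith [sq_nonneg (‖x‖ * jp x)]

lemma norm_mul_jp (x : E3) : ‖x‖ * jp x ≤ 1 := by
  have := w_jp x
  have := jp_pos x
  nlinarith [mul_nonneg (norm_nonneg x) (jp_pos x).le]

lemma continuous_jp : Continuous jp := by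
  unfold jp
  refine Continuous.inv₀ (by fun_prop) (fun x => by positivity)

lemma integrable_jp_four : Integrable (fun x : E3 => jp x ^ 4) := by
  have h := integrable_rpow_neg_one_add_norm_sq (E := E3) (μ := volume) (r := 4)
    (by simp; norm_num)
  refine h.congr (Eventually.of_forall fun x => ?_)
  have : jp x ^ 4 = (jp x ^ 2) ^ 2 := by ring
  simp only [this, jp_sq]
  rw [show (-4 / 2 : ℝ) = -((2 : ℕ) : ℝ) by norm_num, Real.rpow_neg (by positivity),
    Real.rpow_natCast, inv_pow]

lemma integrable_of_jp {F : Type*} [NormedAddCommGroup F] {f : E3 → F} (hf : Continuous f) {C : ℝ}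
    (hb : ∀ x, ‖f x‖ ≤ C * jp x ^ 4) : Integrable f :=
  (integrable_jp_four.const_mul C).mono' hf.aestronglyMeasurable (Eventually.of_forall hb)

lemma peetre (x y : E3) : jp (x - y) * jp y ≤ 2 * jp x := by
  have h1 : ‖x‖ ≤ ‖x - y‖ + ‖y‖ := by simpa using norm_add_le (x - y) y
  have e1 := w_jp x
  have e2 := w_jp (x - y)
  have e3 := w_jp y
  have hx := jp_pos x
  have hy := jp_pos y
  have hz := jp_pos (x - y)
  refine abs_le_of_sq_le_sq' ?_ (by positivity) |>.2
  have hw : (1 + ‖x‖ ^ 2) ≤ 4 * ((1 + ‖x - y‖ ^ 2) * (1 + ‖y‖ ^ 2)) := by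
    nlinarith [norm_nonneg x, norm_nonneg y, norm_nonneg (x - y), sq_nonneg (‖x - y‖ - ‖y‖),
      mul_nonneg (sq_nonneg (‖x-y‖)) (sq_nonneg (‖y‖))]
  have := mul_le_mul_of_nonneg_right hw
    (by positivity : 0 ≤ (jp x ^ 2 * (jp (x - y) ^ 2 * jp y ^ 2)))
  calc (jp (x - y) * jp y) ^ 2 = ((1 + ‖x‖ ^ 2) * jp x ^ 2) * (jp (x - y) ^ 2 * jp y ^ 2) := by
        rw [e1]; ring
    _ ≤ 4 * (((1 + ‖x - y‖ ^ 2) * jp (x - y) ^ 2) * ((1 + ‖y‖ ^ 2) * jp y ^ 2)) * jp x ^ 2 := by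
        linarith
    _ = (2 * jp x) ^ 2 := by rw [e2, e3]; ring

lemma abs_coord (x : E3) (i : Fin 3) : |x i| ≤ ‖x‖ := by
  simpa using PiLp.norm_apply_le x i

section LD
variable {v x : E3} 

lemma ld_mul {f g : E3 → ℝ} {f' g' : ℝ} (hf : HasLineDerivAt ℝ f f' x v)
    (hg : HasLineDerivAt ℝ g g' x v) :
    HasLineDerivAt ℝ (fun y => f y * g y) (f' * g x + f x * g') x v := by
  unfold HasLineDerivAt at *
  simpa using hf.fun_mul hg

lemma ld_smul {F : Type*} [NormedAddCommGroup F] [NormedSpace ℝ F] 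
    {f : E3 → ℝ} {g : E3 → F} {f' : ℝ} {g' : F} (hf : HasLineDerivAt ℝ f f' x v)
    (hg : HasLineDerivAt ℝ g g' x v) :
    HasLineDerivAt ℝ (fun y => f y • g y) (f x • g' + f' • g x) x v := by
  unfold HasLineDerivAt at *
  simpa using hf.fun_smul hg

lemma ld_add {F : Type*} [NormedAddCommGroup F] [NormedSpace ℝ F] 
    {f g : E3 → F} {f' g' : F} (hf : HasLineDerivAt ℝ f f' x v)
    (hg : HasLineDerivAt ℝ g g' x v) :
    HasLineDerivAt ℝ (fun y => f y + g y) (f' + g') x v := by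
  unfold HasLineDerivAt at *
  simpa using hf.fun_add hg

lemma ld_qmul (a : Quaternion ℝ) {f : E3 → Quaternion ℝ} {f' : Quaternion ℝ}
    (hf : HasLineDerivAt ℝ f f' x v) :
    HasLineDerivAt ℝ (fun y => a * f y) (a * f') x v := by
  unfold HasLineDerivAt at *
  simpa using hf.const_mul a

lemma ld_inner {f g : E3 → Quaternion ℝ} {f' g' : Quaternion ℝ} (hf : HasLineDerivAt ℝ f f' x v)
    (hg : HasLineDerivAt ℝ g g' x v) :
    HasLineDerivAt ℝ (fun y => inner ℝ (f y) (g y)) (inner ℝ (f x) g' + inner ℝ f' (g x)) x v := by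
  unfold HasLineDerivAt at *
  simpa using HasDerivAt.inner ℝ hf hg

lemma ld_w (x v : E3) : HasLineDerivAt ℝ (fun y : E3 => ‖y‖ ^ 2) (2 * inner ℝ x v) x v := by
  have := ((hasStrictFDerivAt_norm_sq x).hasFDerivAt).hasLineDerivAt v
  simpa using this

lemma ld_coord (x v : E3) (i : Fin 3) : HasLineDerivAt ℝ (fun y : E3 => y i) (v i) x v := by
  have := ((EuclideanSpace.proj (𝕜 := ℝ) i : E3 →L[ℝ] ℝ).hasFDerivAt (x := x)).hasLineDerivAt v
  simpa using this

lemma ld_comp {f : E3 → ℝ} {f' : ℝ} {φ : ℝ → ℝ} {φ' : ℝ} (hφ : HasDerivAt φ φ' (f x))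
    (hf : HasLineDerivAt ℝ f f' x v) : HasLineDerivAt ℝ (fun y => φ (f y)) (φ' * f') x v := by
  unfold HasLineDerivAt at *
  exact HasDerivAt.comp (0:ℝ) (h₂ := φ) (h := fun t : ℝ => f (x + t • v)) (by simpa using hφ) hf
end LD

lemma integral_line_deriv_zero {f f' : E3 → ℝ} {v : E3} {C : ℝ} (hf : Continuous f)
    (hf' : Integrable f') (hb : ∀ x, |f x| ≤ C * jp x ^ 3)
    (hd : ∀ x, HasLineDerivAt ℝ f (f' x) x v) : ∫ x, f' x = 0 := by
  set δ : ℕ → ℝ := fun n => 1 / ((n : ℝ) + 1) with hδ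
  have δ0 : ∀ n, 0 < δ n := fun n => by simp only [hδ]; positivity
  have δ1 : ∀ n, δ n ≤ 1 := fun n => by
    simp only [hδ]; rw [div_le_one (by positivity)]; linarith [Nat.cast_nonneg (α := ℝ) n]
  have δlim : Tendsto δ atTop (𝓝 0) := tendsto_one_div_add_atTop_nhds_zero_nat
  have C0 : 0 ≤ C := by
    have := (abs_nonneg _).trans (hb 0)
    have h2 := pow_pos (jp_pos 0) 3
    exact nonneg_of_mul_nonneg_left this h2
  set χ : ℕ → E3 → ℝ := fun n x => (1 + δ n * ‖x‖ ^ 2)⁻¹ with hχ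
  set χ' : ℕ → E3 → ℝ := fun n x => -(χ n x) ^ 2 * (δ n * (2 * inner ℝ x v)) with hχ'
  have hpos : ∀ n (x : E3), 0 < 1 + δ n * ‖x‖ ^ 2 := fun n x => by have := δ0 n; positivity
  have χpos : ∀ n x, 0 < χ n x := fun n x => inv_pos.2 (hpos n x)
  have χeq : ∀ n x, (1 + δ n * ‖x‖ ^ 2) * χ n x = 1 := fun n x => mul_inv_cancel₀ (hpos n x).ne'
  have χ1 : ∀ n x, χ n x ≤ 1 := fun n x => by
    have := χeq n x
    have : 0 ≤ δ n * ‖x‖ ^ 2 * χ n x := by have := δ0 n; have := χpos n x; positivity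
    linarith
  have χcont : ∀ n, Continuous (χ n) := fun n => by
    refine Continuous.inv₀ (by fun_prop) (fun x => (hpos n x).ne')
  have χ'cont : ∀ n, Continuous (χ' n) := fun n => by
    have := χcont n
    simp only [hχ']; fun_prop
  have χd : ∀ n x, HasLineDerivAt ℝ (χ n) (χ' n x) x v := fun n x => by
    have h := ld_comp (φ := fun s => (1 + δ n * s)⁻¹) (φ' := -(δ n) / (1 + δ n * ‖x‖ ^ 2) ^ 2) ?_ (ld_w x v)
    · convert h using 1
      simp only [hχ', hχ]; field_simp
    · have h1 : HasDerivAt (fun s : ℝ => 1 + δ n * s) (δ n) (‖x‖ ^ 2) := by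
        simpa using ((hasDerivAt_id (‖x‖ ^ 2)).const_mul (δ n)).const_add 1
      simpa using h1.fun_inv (hpos n x).ne'
  have χ'b : ∀ n x, |χ' n x| ≤ 2 * ‖v‖ * jp x := fun n x => by
    have h1 : |inner ℝ x v| ≤ ‖x‖ * ‖v‖ := abs_real_inner_le_norm x v
    have h2 : δ n * ‖x‖ * χ n x ≤ jp x := by
      have e := w_jp x
      have h3 : δ n * (1 + ‖x‖ ^ 2) * χ n x ≤ 1 := by
        refine le_trans ?_ (χeq n x).le
        exact mul_le_mul_of_nonneg_right (by nlinarith [δ1 n]) (χpos n x).le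
      calc δ n * ‖x‖ * χ n x = (δ n * (1 + ‖x‖ ^ 2) * χ n x) * (‖x‖ * jp x) * jp x := by
            linear_combination (-δ n * ‖x‖ * χ n x) * e
        _ ≤ 1 * 1 * jp x := by
            have := jp_pos x
            have := χpos n x
            have := δ0 n
            gcongr
            exact norm_mul_jp x
        _ = jp x := by ring
    simp only [hχ', abs_mul, abs_neg, abs_pow, abs_of_pos (χpos n x), abs_of_pos (δ0 n), abs_two]
    have := jp_pos x
    have := χpos n x
    have := δ0 n
    calc χ n x ^ 2 * (δ n * (2 * |inner ℝ x v|)) ≤ χ n x ^ 2 * (δ n * (2 * (‖x‖ * ‖v‖))) := by gcongr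
      _ = 2 * ‖v‖ * (δ n * ‖x‖ * χ n x) * χ n x := by ring
      _ ≤ 2 * ‖v‖ * jp x * 1 := by gcongr; exact χ1 n x
      _ = _ := by ring
  have I1 : ∀ n, Integrable (fun x => χ' n x * f x) := fun n => by
    refine integrable_of_jp (C := 2 * ‖v‖ * C) ((χ'cont n).mul hf) fun x => ?_
    rw [norm_mul, Real.norm_eq_abs, Real.norm_eq_abs]
    calc _ ≤ (2 * ‖v‖ * jp x) * (C * jp x ^ 3) := by
          have := jp_pos x
          exact mul_le_mul (χ'b n x) (hb x) (abs_nonneg _) (by positivity)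
      _ = _ := by ring
  have I2 : ∀ n, Integrable (fun x => χ n x * f' x) := fun n => by
    refine hf'.norm.mono' ((χcont n).aestronglyMeasurable.mul hf'.1) (Eventually.of_forall fun x => ?_)
    rw [norm_mul]
    have : ‖χ n x‖ ≤ 1 := by rw [Real.norm_eq_abs, abs_of_pos (χpos n x)]; exact χ1 n x
    nlinarith [norm_nonneg (f' x)]
  have I3 : ∀ n, Integrable (fun x => χ n x * f x) := fun n => by
    refine integrable_of_jp (C := (δ n)⁻¹ * C) ((χcont n).mul hf) fun x => ?_
    rw [norm_mul, Real.norm_eq_abs, Real.norm_eq_abs, abs_of_pos (χpos n x)]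
    have h0 := δ0 n
    have h1 : χ n x ≤ (δ n)⁻¹ * jp x ^ 2 := by
      rw [jp_sq, ← mul_inv]
      apply inv_anti₀ (by positivity)
      nlinarith [δ1 n]
    have := jp_pos x
    calc _ ≤ ((δ n)⁻¹ * jp x ^ 2) * (C * jp x ^ 3) := 
          mul_le_mul h1 (hb x) (abs_nonneg _) (by positivity)
      _ = (δ n)⁻¹ * C * jp x ^ 4 * jp x := by ring
      _ ≤ (δ n)⁻¹ * C * jp x ^ 4 * 1 := by gcongr; exact jp_le_one x
      _ = _ := by ring
  have key : ∀ n, ∫ x, χ n x * f' x = - ∫ x, χ' n x * f x := fun n =>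
    integral_bilinear_hasLineDerivAt_right_eq_neg_left_of_integrable (B := ContinuousLinearMap.mul ℝ ℝ)
      (I1 n) (I2 n) (I3 n) (fun x _ => χd n x) (fun x _ => hd x)
  have L1 : Tendsto (fun n => ∫ x, χ n x * f' x) atTop (𝓝 (∫ x, f' x)) := by
    refine tendsto_integral_of_dominated_convergence (fun x => ‖f' x‖) (fun n => (I2 n).1) hf'.norm
      (fun n => Eventually.of_forall fun x => ?_) (Eventually.of_forall fun x => ?_)
    · rw [norm_mul]
      have : ‖χ n x‖ ≤ 1 := by rw [Real.norm_eq_abs, abs_of_pos (χpos n x)]; exact χ1 n x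
      nlinarith [norm_nonneg (f' x)]
    · have : Tendsto (fun n => (1 + δ n * ‖x‖ ^ 2)⁻¹ * f' x) atTop (𝓝 ((1 + 0 * ‖x‖ ^ 2)⁻¹ * f' x)) :=
        (((δlim.mul_const _).const_add 1).inv₀ (by simp)).mul_const _
      simpa using this
  have L2 : Tendsto (fun n => ∫ x, χ' n x * f x) atTop (𝓝 (∫ x : E3, (0:ℝ))) := by
    refine tendsto_integral_of_dominated_convergence (fun x => 2 * ‖v‖ * C * jp x ^ 4) (fun n => (I1 n).1)
      (integrable_jp_four.const_mul _)
      (fun n => Eventually.of_forall fun x => ?_) (Eventually.of_forall fun x => ?_)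
    · rw [norm_mul, Real.norm_eq_abs, Real.norm_eq_abs]
      calc _ ≤ (2 * ‖v‖ * jp x) * (C * jp x ^ 3) := by
            have := jp_pos x
            exact mul_le_mul (χ'b n x) (hb x) (abs_nonneg _) (by positivity)
        _ = _ := by ring
    · have h1 : Tendsto (fun n => (1 + δ n * ‖x‖ ^ 2)⁻¹) atTop (𝓝 ((1 + 0 * ‖x‖ ^ 2)⁻¹)) :=
        (((δlim.mul_const _).const_add 1).inv₀ (by simp))
      have h2 := (((h1.pow 2).neg).mul (δlim.mul_const (2 * inner ℝ x v))).mul_const (f x)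
      simpa only [zero_mul, mul_zero] using h2
  have L3 := L1.congr key
  have := tendsto_nhds_unique L3 L2.neg
  simpa using this


lemma ld_congr {f f1 : E3 → ℝ} {f' f1' : ℝ} {x v : E3} (h : HasLineDerivAt ℝ f f' x v)
    (hf : ∀ y, f1 y = f y) (e : f1' = f') : HasLineDerivAt ℝ f1 f1' x v := by
  rw [e, show f1 = f from funext hf]; exact h

lemma qinner (a b : Quaternion ℝ) : inner ℝ a b =
    a.re * b.re + a.imI * b.imI + a.imJ * b.imJ + a.imK * b.imK := by
  rw [Quaternion.inner_def]; simp

/-- The quaternion units. -/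
def qe : Fin 3 → Quaternion ℝ := ![⟨0, 1, 0, 0⟩, ⟨0, 0, 1, 0⟩, ⟨0, 0, 0, 1⟩]

lemma norm_qe (i : Fin 3) : ‖qe i‖ = 1 := by
  have : ‖qe i‖ ^ 2 = 1 := by
    rw [← real_inner_self_eq_norm_sq, qinner]
    fin_cases i <;> simp [qe]
  nlinarith [norm_nonneg (qe i)]

lemma qe0_mul_re (a : Quaternion ℝ) : (qe 0 * a).re = -a.imI := by
  rw [Quaternion.re_mul]; simp [qe]

lemma qe0_mul_imI (a : Quaternion ℝ) : (qe 0 * a).imI = a.re := by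
  rw [Quaternion.imI_mul]; simp [qe]

lemma qe0_mul_imJ (a : Quaternion ℝ) : (qe 0 * a).imJ = -a.imK := by
  rw [Quaternion.imJ_mul]; simp [qe]

lemma qe0_mul_imK (a : Quaternion ℝ) : (qe 0 * a).imK = a.imJ := by
  rw [Quaternion.imK_mul]; simp [qe]

lemma qe1_mul_re (a : Quaternion ℝ) : (qe 1 * a).re = -a.imJ := by
  rw [Quaternion.re_mul]; simp [qe]

lemma qe1_mul_imI (a : Quaternion ℝ) : (qe 1 * a).imI = a.imK := by
  rw [Quaternion.imI_mul]; simp [qe]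

lemma qe1_mul_imJ (a : Quaternion ℝ) : (qe 1 * a).imJ = a.re := by
  rw [Quaternion.imJ_mul]; simp [qe]

lemma qe1_mul_imK (a : Quaternion ℝ) : (qe 1 * a).imK = -a.imI := by
  rw [Quaternion.imK_mul]; simp [qe]

lemma qe2_mul_re (a : Quaternion ℝ) : (qe 2 * a).re = -a.imK := by
  rw [Quaternion.re_mul]; simp [qe]

lemma qe2_mul_imI (a : Quaternion ℝ) : (qe 2 * a).imI = -a.imJ := by
  rw [Quaternion.imI_mul]; simp [qe]

lemma qe2_mul_imJ (a : Quaternion ℝ) : (qe 2 * a).imJ = a.imI := by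
  rw [Quaternion.imJ_mul]; simp [qe]

lemma qe2_mul_imK (a : Quaternion ℝ) : (qe 2 * a).imK = a.re := by
  rw [Quaternion.imK_mul]; simp [qe]

lemma alg (x0 x1 x2 w : ℝ) (u d0 d1 d2 h01 h02 h12 : Quaternion ℝ)
    (hw : w = 1 + (x0 ^ 2 + x1 ^ 2 + x2 ^ 2)) :
    w * ((2 * x0 * inner ℝ (qe 0 * u) (qe 1 * d1 + qe 2 * d2) +
        w * (inner ℝ (qe 0 * u) (qe 1 * h01 + qe 2 * h02) + inner ℝ (qe 0 * d0) (qe 1 * d1 + qe 2 * d2))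
        - 2 * inner ℝ u u - 4 * x0 * inner ℝ u d0) +
      (2 * x1 * inner ℝ (qe 1 * u) (qe 2 * d2 + qe 0 * d0) +
        w * (inner ℝ (qe 1 * u) (qe 2 * h12 + qe 0 * h01) + inner ℝ (qe 1 * d1) (qe 2 * d2 + qe 0 * d0))
        - 2 * inner ℝ u u - 4 * x1 * inner ℝ u d1) +
      (2 * x2 * inner ℝ (qe 2 * u) (qe 0 * d0 + qe 1 * d1) +
        w * (inner ℝ (qe 2 * u) (qe 0 * h02 + qe 1 * h12) + inner ℝ (qe 2 * d2) (qe 0 * d0 + qe 1 * d1))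
        - 2 * inner ℝ u u - 4 * x2 * inner ℝ u d2)) ≤
    (2 / 3) * w ^ 2 * inner ℝ (qe 0 * d0 + qe 1 * d1 + qe 2 * d2) (qe 0 * d0 + qe 1 * d1 + qe 2 * d2)
      - 6 * inner ℝ u u := by
  obtain ⟨D, hD⟩ : ∃ D, D = qe 0 * d0 + qe 1 * d1 + qe 2 * d2 := ⟨_, rfl⟩
  obtain ⟨X, hX⟩ : ∃ X, X = x0 • qe 0 + x1 • qe 1 + x2 • qe 2 := ⟨_, rfl⟩
  have P : ∀ a : Quaternion ℝ, 0 ≤ inner ℝ a a := fun a => real_inner_self_nonneg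
  have p0 := P (w • d0 + (3 * x0) • u + (1 / 3 : ℝ) • (qe 0 * (w • D + (3:ℝ) • (X * u))))
  have p1 := P (w • d1 + (3 * x1) • u + (1 / 3 : ℝ) • (qe 1 * (w • D + (3:ℝ) • (X * u))))
  have p2 := P (w • d2 + (3 * x2) • u + (1 / 3 : ℝ) • (qe 2 * (w • D + (3:ℝ) • (X * u))))
  refine le_of_sub_nonneg (le_of_le_of_eq (add_nonneg (add_nonneg p0 p1) p2) ?_)
  subst hD hX
  clear p0 p1 p2 P
  simp only [add_mul, smul_mul_assoc, qinner, qe0_mul_re, qe0_mul_imI, qe0_mul_imJ, qe0_mul_imK, qe1_mul_re, qe1_mul_imI,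
    qe1_mul_imJ, qe1_mul_imK, qe2_mul_re, qe2_mul_imI, qe2_mul_imJ, qe2_mul_imK, Quaternion.re_add,
    Quaternion.imI_add, Quaternion.imJ_add, Quaternion.imK_add, 
    Quaternion.re_smul, Quaternion.imI_smul, Quaternion.imJ_smul, Quaternion.imK_smul, smul_eq_mul]
  linear_combination (-6) * (u.re ^ 2 + u.imI ^ 2 + u.imJ ^ 2 + u.imK ^ 2) * hw

/-- The vector field in the integration by parts. -/
def Fv (u : E3 → Quaternion ℝ) (d : Fin 3 → E3 → Quaternion ℝ) (i : Fin 3) (x : E3) : ℝ :=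
  (1 + ‖x‖ ^ 2) * inner ℝ (qe i * u x) (qe (i + 1) * d (i + 1) x + qe (i + 2) * d (i + 2) x)
    + (-2 * x i) * inner ℝ (u x) (u x)

/-- Its partial derivative. -/
def Fd (u : E3 → Quaternion ℝ) (d : Fin 3 → E3 → Quaternion ℝ)
    (dd : Fin 3 → Fin 3 → E3 → Quaternion ℝ) (i : Fin 3) (x : E3) : ℝ :=
  2 * x i * inner ℝ (qe i * u x) (qe (i + 1) * d (i + 1) x + qe (i + 2) * d (i + 2) x) +
    (1 + ‖x‖ ^ 2) * (inner ℝ (qe i * u x) (qe (i + 1) * dd i (i + 1) x + qe (i + 2) * dd i (i + 2) x) +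
      inner ℝ (qe i * d i x) (qe (i + 1) * d (i + 1) x + qe (i + 2) * d (i + 2) x))
    - 2 * inner ℝ (u x) (u x) - 4 * x i * inner ℝ (u x) (d i x)

lemma norm_sq_coord (x : E3) : ‖x‖ ^ 2 = x 0 ^ 2 + x 1 ^ 2 + x 2 ^ 2 := by
  rw [EuclideanSpace.norm_sq_eq, Fin.sum_univ_three]; simp

lemma norm_qe_mul (i : Fin 3) (a : Quaternion ℝ) : ‖qe i * a‖ = ‖a‖ := by
  rw [norm_mul, norm_qe, one_mul]

lemma inner_bound {a b : Quaternion ℝ} {A B : ℝ} (ha : ‖a‖ ≤ A) (hb : ‖b‖ ≤ B) :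
    |inner ℝ a b| ≤ A * B :=
  (abs_real_inner_le_norm a b).trans
    (mul_le_mul ha hb (norm_nonneg _) ((norm_nonneg _).trans ha))

lemma core (u : E3 → Quaternion ℝ) (d : Fin 3 → E3 → Quaternion ℝ)
    (dd : Fin 3 → Fin 3 → E3 → Quaternion ℝ) (C : ℝ)
    (cu : Continuous u) (cd : ∀ i, Continuous (d i)) (cdd : ∀ i j, Continuous (dd i j))
    (hu : ∀ i x, HasLineDerivAt ℝ u (d i x) x (EuclideanSpace.single i 1))
    (hd : ∀ i j x, HasLineDerivAt ℝ (d j) (dd i j x) x (EuclideanSpace.single i 1))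
    (sym : ∀ i j x, dd i j x = dd j i x)
    (bu : ∀ x, ‖u x‖ ≤ C * jp x ^ 2) (bd : ∀ i x, ‖d i x‖ ≤ C * jp x ^ 3)
    (bdd : ∀ i j x, ‖dd i j x‖ ≤ C * jp x ^ 4) :
    9 * ∫ x, ‖u x‖ ^ 2 / (1 + ‖x‖ ^ 2) ≤
      ∫ x, ‖qe 0 * d 0 x + qe 1 * d 1 x + qe 2 * d 2 x‖ ^ 2 * (1 + ‖x‖ ^ 2) := by
  have C0 : 0 ≤ C := by
    have := (norm_nonneg _).trans (bu 0)
    exact nonneg_of_mul_nonneg_left this (pow_pos (jp_pos 0) 2)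
  have cFv : ∀ i, Continuous (Fv u d i) := fun i => by
    have := cd (i + 1); have := cd (i + 2)
    unfold Fv; fun_prop
  have cFd : ∀ i, Continuous (Fd u d dd i) := fun i => by
    have := cd i; have := cd (i + 1); have := cd (i + 2)
    have := cdd i (i + 1); have := cdd i (i + 2)
    unfold Fd; fun_prop
  have bg : ∀ i j x, ‖qe i * d i x + qe j * d j x‖ ≤ 2 * C * jp x ^ 3 := fun i j x => by
    refine (norm_add_le _ _).trans ?_
    rw [norm_qe_mul, norm_qe_mul]
    linarith [bd i x, bd j x]
  have bgg : ∀ i j k x, ‖qe i * dd k i x + qe j * dd k j x‖ ≤ 2 * C * jp x ^ 4 := fun i j k x => by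
    refine (norm_add_le _ _).trans ?_
    rw [norm_qe_mul, norm_qe_mul]
    linarith [bdd k i x, bdd k j x]
  have bqu : ∀ i x, ‖qe i * u x‖ ≤ C * jp x ^ 2 := fun i x => by rw [norm_qe_mul]; exact bu x
  have bqd : ∀ i x, ‖qe i * d i x‖ ≤ C * jp x ^ 3 := fun i x => by rw [norm_qe_mul]; exact bd i x
  have bx : ∀ i (x : E3), |x i| * jp x ≤ 1 := fun i x =>
    (mul_le_mul_of_nonneg_right (abs_coord x i) (jp_pos x).le).trans (norm_mul_jp x)
  have bFv : ∀ i x, |Fv u d i x| ≤ (4 * C ^ 2) * jp x ^ 3 := fun i x => by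
    have hp := jp_pos x
    have e := w_jp x
    have h1 := inner_bound (bqu i x) (bg (i + 1) (i + 2) x)
    have h2 := inner_bound (bu x) (bu x)
    unfold Fv
    refine (abs_add_le _ _).trans ?_
    rw [abs_mul, abs_mul, abs_mul, abs_neg, abs_two, abs_of_pos (by positivity : 0 < 1 + ‖x‖ ^ 2)]
    calc _ ≤ (1 + ‖x‖ ^ 2) * (C * jp x ^ 2 * (2 * C * jp x ^ 3)) +
          2 * |x i| * (C * jp x ^ 2 * (C * jp x ^ 2)) := by gcongr
      _ = 2 * C ^ 2 * jp x ^ 3 + 2 * C ^ 2 * jp x ^ 3 * (|x i| * jp x) := by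
          linear_combination 2 * C ^ 2 * jp x ^ 3 * e
      _ ≤ 2 * C ^ 2 * jp x ^ 3 + 2 * C ^ 2 * jp x ^ 3 * 1 := by gcongr; exact bx i x
      _ = _ := by ring
  have bFd : ∀ i x, ‖Fd u d dd i x‖ ≤ (14 * C ^ 2) * jp x ^ 4 := fun i x => by
    have hp := jp_pos x
    have e := w_jp x
    have h1 := inner_bound (bqu i x) (bg (i + 1) (i + 2) x)
    have h2 := inner_bound (bu x) (bu x)
    have h3 := inner_bound (bqu i x) (bgg (i + 1) (i + 2) i x)
    have h4 := inner_bound (bqd i x) (bg (i + 1) (i + 2) x)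
    have h5 := inner_bound (bu x) (bd i x)
    unfold Fd
    rw [Real.norm_eq_abs]
    refine (abs_sub _ _).trans ?_
    refine (add_le_add_left (abs_sub _ _) _).trans ?_
    refine (add_le_add_left (add_le_add_left (abs_add_le _ _) _) _).trans ?_
    rw [abs_mul, abs_mul, abs_mul, abs_mul, abs_mul, abs_mul, abs_two, abs_of_pos (by positivity : 0 < 1 + ‖x‖ ^ 2),
      abs_of_pos (by norm_num : (0:ℝ) < 4)]
    calc _ ≤ 2 * |x i| * (C * jp x ^ 2 * (2 * C * jp x ^ 3)) +
        (1 + ‖x‖ ^ 2) * (C * jp x ^ 2 * (2 * C * jp x ^ 4) + C * jp x ^ 3 * (2 * C * jp x ^ 3)) +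
        2 * (C * jp x ^ 2 * (C * jp x ^ 2)) + 4 * |x i| * (C * jp x ^ 2 * (C * jp x ^ 3)) := by
          gcongr
          exact (abs_add_le _ _).trans (add_le_add h3 h4)
      _ = 6 * C ^ 2 * jp x ^ 4 + 8 * C ^ 2 * jp x ^ 4 * (|x i| * jp x) := by
          linear_combination 4 * C ^ 2 * jp x ^ 4 * e
      _ ≤ 6 * C ^ 2 * jp x ^ 4 + 8 * C ^ 2 * jp x ^ 4 * 1 := by gcongr; exact bx i x
      _ = _ := by ring
  have iFd : ∀ i, Integrable (Fd u d dd i) := fun i => integrable_of_jp (cFd i) (bFd i)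
  have der : ∀ i x, HasLineDerivAt ℝ (Fv u d i) (Fd u d dd i x) x (EuclideanSpace.single i 1) := by
    intro i x
    have w1 : HasLineDerivAt ℝ (fun y : E3 => 1 + ‖y‖ ^ 2) (2 * x i) x (EuclideanSpace.single i 1) := by
      have h := ld_comp (φ := fun s => 1 + s) (φ' := 1) ((hasDerivAt_id _).const_add 1)
        (ld_w x (EuclideanSpace.single i 1))
      convert h using 1
      simp [EuclideanSpace.inner_single_right]
    have x1 : HasLineDerivAt ℝ (fun y : E3 => -2 * y i) (-2) x (EuclideanSpace.single i 1) := by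
      have h := ld_comp (φ := fun s => -2 * s) (φ' := -2)
        (by simpa using (hasDerivAt_id (x i)).const_mul (-2))
        (ld_coord x (EuclideanSpace.single i 1) i)
      convert h using 1
      simp
    have h1 := ld_inner (ld_qmul (qe i) (hu i x))
      (ld_add (ld_qmul (qe (i + 1)) (hd i (i + 1) x)) (ld_qmul (qe (i + 2)) (hd i (i + 2) x)))
    have h := ld_add (ld_mul w1 h1) (ld_mul x1 (ld_inner (hu i x) (hu i x)))
    refine ld_congr h (fun y => rfl) ?_
    unfold Fd
    rw [real_inner_comm (u x) (d i x)]
    ring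
  have z : ∀ i, ∫ x, Fd u d dd i x = 0 := fun i =>
    integral_line_deriv_zero (cFv i) (iFd i) (bFv i) (der i)
  have zs : ∫ x, (Fd u d dd 0 x + Fd u d dd 1 x + Fd u d dd 2 x) = 0 := by
    have i2 : Integrable (fun x => Fd u d dd 0 x + Fd u d dd 1 x) := (iFd 0).add (iFd 1)
    rw [integral_add i2 (iFd 2), integral_add (iFd 0) (iFd 1), z, z, z]; simp
  set D : E3 → Quaternion ℝ := fun x => qe 0 * d 0 x + qe 1 * d 1 x + qe 2 * d 2 x with hD
  have cD : Continuous D := by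
    have := cd 0; have := cd 1; have := cd 2
    simp only [hD]; fun_prop
  have bD : ∀ x, ‖D x‖ ≤ 3 * C * jp x ^ 3 := fun x => by
    refine (norm_add_le _ _).trans ?_
    have := bg 0 1 x
    have := bqd 2 x
    linarith
  have iD : Integrable (fun x => ‖D x‖ ^ 2 * (1 + ‖x‖ ^ 2)) := by
    refine integrable_of_jp (C := (3 * C) ^ 2) (by fun_prop) fun x => ?_
    have e := w_jp x
    rw [Real.norm_eq_abs, abs_of_nonneg (by positivity)]
    calc _ ≤ (3 * C * jp x ^ 3) ^ 2 * (1 + ‖x‖ ^ 2) := by gcongr; exact bD x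
      _ = _ := by linear_combination (3 * C * jp x ^ 2) ^ 2 * e
  have iu : Integrable (fun x => ‖u x‖ ^ 2 / (1 + ‖x‖ ^ 2)) := by
    refine integrable_of_jp (C := C ^ 2)
      (Continuous.div (by fun_prop) (by fun_prop) fun x => by positivity) fun x => ?_
    rw [Real.norm_eq_abs, abs_of_nonneg (by positivity), div_eq_mul_inv, ← jp_sq]
    calc _ ≤ (C * jp x ^ 2) ^ 2 * 1 := by
          gcongr
          · exact bu x
          · exact pow_le_one₀ (jp_pos x).le (jp_le_one x)
      _ = _ := by ring
  have pw : ∀ x, Fd u d dd 0 x + Fd u d dd 1 x + Fd u d dd 2 x ≤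
      (2 / 3) * (‖D x‖ ^ 2 * (1 + ‖x‖ ^ 2)) - 6 * (‖u x‖ ^ 2 / (1 + ‖x‖ ^ 2)) := fun x => by
    have h := alg (x 0) (x 1) (x 2) (1 + ‖x‖ ^ 2) (u x) (d 0 x) (d 1 x) (d 2 x)
      (dd 0 1 x) (dd 0 2 x) (dd 1 2 x) (by rw [norm_sq_coord])
    have wp : 0 < 1 + ‖x‖ ^ 2 := by positivity
    have h' : (1 + ‖x‖ ^ 2) * (Fd u d dd 0 x + Fd u d dd 1 x + Fd u d dd 2 x) ≤
        (2 / 3) * (1 + ‖x‖ ^ 2) ^ 2 * ‖D x‖ ^ 2 - 6 * ‖u x‖ ^ 2 := by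
      rw [← real_inner_self_eq_norm_sq (D x), ← real_inner_self_eq_norm_sq (u x)]
      refine le_trans (le_of_eq ?_) h
      unfold Fd
      have a1 : (1 : Fin 3) + 1 = 2 := rfl
      have a2 : (1 : Fin 3) + 2 = 0 := rfl
      have a3 : (2 : Fin 3) + 1 = 0 := rfl
      have a4 : (2 : Fin 3) + 2 = 1 := rfl
      simp only [a1, a2, a3, a4, zero_add]
      rw [sym 1 0 x, sym 2 0 x, sym 2 1 x]
    refine le_of_mul_le_mul_left (h'.trans (le_of_eq ?_)) wp
    field_simp
  have fin := integral_mono (((iFd 0).add (iFd 1)).add (iFd 2))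
    ((iD.const_mul (2 / 3)).sub (iu.const_mul 6)) pw
  have fin2 : (0:ℝ) ≤ (2 / 3) * (∫ x, ‖D x‖ ^ 2 * (1 + ‖x‖ ^ 2)) -
      6 * ∫ x, ‖u x‖ ^ 2 / (1 + ‖x‖ ^ 2) := by
    rw [← integral_const_mul, ← integral_const_mul, 
      ← integral_sub (iD.const_mul (2 / 3)) (iu.const_mul 6)]
    exact zs.symm.le.trans fin
  linarith


section conv
variable {h : E3 → Quaternion ℝ}

/-- Convolution with a scalar kernel. -/
def cv (k : E3 → ℝ) (h : E3 → Quaternion ℝ) (x : E3) : Quaternion ℝ := ∫ y, k (x - y) • h y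

lemma cv_int (hc : Continuous h) (hs : HasCompactSupport h) {k : E3 → ℝ} (hk : Continuous k) (x : E3) :
    Integrable (fun y => k (x - y) • h y) := by
  apply Continuous.integrable_of_hasCompactSupport (by fun_prop)
  exact hs.smul_left (f := fun y => k (x - y))

lemma cv_cont (hc : Continuous h) (hs : HasCompactSupport h) {k : E3 → ℝ} (hk : Continuous k)
    {M : ℝ} (hM : ∀ x, |k x| ≤ M) : Continuous (cv k h) := by
  refine continuous_of_dominated (bound := fun y => M * ‖h y‖)
    (fun x => (cv_int hc hs hk x).1) (fun x => Eventually.of_forall fun y => ?_)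
    ((hc.integrable_of_hasCompactSupport hs).norm.const_mul M) 
    (Eventually.of_forall fun y => by fun_prop)
  rw [norm_smul]; gcongr; exact hM _

lemma cv_ld (hc : Continuous h) (hs : HasCompactSupport h) {k k' : E3 → ℝ} (hk : Continuous k)
    (hk' : Continuous k') {M : ℝ} (hM : ∀ x, |k' x| ≤ M) {v : E3}
    (hd : ∀ x, HasLineDerivAt ℝ k (k' x) x v) (x : E3) :
    HasLineDerivAt ℝ (cv k h) (cv k' h x) x v := by
  have := hasDerivAt_integral_of_dominated_loc_of_deriv_le (μ := (volume : Measure E3)) (𝕜 := ℝ)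
    (F := fun t y => k (x + t • v - y) • h y) (F' := fun t y => k' (x + t • v - y) • h y)
    (x₀ := 0) (s := Set.univ) (bound := fun y => M * ‖h y‖) univ_mem
    (Eventually.of_forall fun t => (cv_int hc hs hk _).1) (cv_int hc hs hk _)
    (cv_int hc hs hk' _).1
    (Eventually.of_forall fun y t _ => by
      rw [norm_smul]; gcongr; exact hM _)
    ((hc.integrable_of_hasCompactSupport hs).norm.const_mul M)
    (Eventually.of_forall fun y t _ => by
      refine HasDerivAt.smul_const ?_ (h y)
      have h1 := hd (x + t • v - y)
      unfold HasLineDerivAt at h1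
      have h2 := HasDerivAt.scomp (𝕜' := ℝ) t (g₁ := fun s : ℝ => k (x + t • v - y + s • v)) (h := fun s => s - t) (h' := 1)
        (by simpa using h1) ((hasDerivAt_id t).sub_const t)
      simp only [one_smul] at h2
      refine h2.congr_of_eventuallyEq (Eventually.of_forall fun s => ?_)
      simp only [Function.comp]
      congr 1
      module)
  unfold HasLineDerivAt
  simpa [cv] using this.2

lemma cv_bound (hc : Continuous h) (hs : HasCompactSupport h) {k : E3 → ℝ} (hk : Continuous k)
    {M : ℝ} {m : ℕ} (hM : ∀ x, |k x| ≤ M * jp x ^ m) : ∃ C, ∀ x, ‖cv k h x‖ ≤ C * jp x ^ m := by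
  refine ⟨∫ y, M * (2 / jp y) ^ m * ‖h y‖, fun x => ?_⟩
  have M0 : 0 ≤ M := by
    have := (abs_nonneg _).trans (hM 0)
    exact nonneg_of_mul_nonneg_left this (pow_pos (jp_pos 0) m)
  have cj := continuous_jp
  rw [← integral_mul_const]
  unfold cv
  refine norm_integral_le_of_norm_le ?_ (Eventually.of_forall fun y => ?_)
  · refine Integrable.mul_const ?_ _
    apply Continuous.integrable_of_hasCompactSupport
    · have : ∀ y, jp y ≠ 0 := fun y => (jp_pos y).ne'
      have : Continuous fun y => 2 / jp y := continuous_const.div cj this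
      fun_prop
    · exact hs.norm.mul_left
  · rw [norm_smul, Real.norm_eq_abs]
    have h1 : jp (x - y) ≤ (2 / jp y) * jp x := by
      have := peetre x y
      have hy := jp_pos y
      rw [div_mul_eq_mul_div, le_div_iff₀ hy]; exact this
    have := jp_pos (x - y)
    calc _ ≤ (M * jp (x - y) ^ m) * ‖h y‖ := by gcongr; exact hM _
      _ ≤ (M * ((2 / jp y) * jp x) ^ m) * ‖h y‖ := by gcongr
      _ = _ := by rw [mul_pow]; ring
end conv

/-- Regularized inverse norm. -/
def sg (ε : ℝ) (y : E3) : ℝ := (√(‖y‖ ^ 2 + ε ^ 2))⁻¹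


lemma sg_pos {ε : ℝ} (he : 0 < ε) (y : E3) : 0 < sg ε y := by unfold sg; positivity

lemma sg_sq {ε : ℝ} (he : 0 < ε) (y : E3) : (‖y‖ ^ 2 + ε ^ 2) * sg ε y ^ 2 = 1 := by
  unfold sg; rw [inv_pow, Real.sq_sqrt (by positivity)]; exact mul_inv_cancel₀ (by positivity)

lemma sg_cont {ε : ℝ} (he : 0 < ε) : Continuous (sg ε) := by
  unfold sg
  refine Continuous.inv₀ (by fun_prop) (fun x => by positivity)

lemma sg_le {ε : ℝ} (he : 0 < ε) (he1 : ε ≤ 1) (y : E3) : sg ε y ≤ ε⁻¹ * jp y := by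
  unfold sg jp
  rw [← mul_inv]
  apply inv_anti₀ (by positivity)
  apply Real.le_sqrt_of_sq_le
  rw [mul_pow, Real.sq_sqrt (by positivity)]
  have : ε ^ 2 ≤ 1 := pow_le_one₀ he.le he1
  nlinarith [sq_nonneg ‖y‖]

lemma norm_mul_sg {ε : ℝ} (he : 0 < ε) (y : E3) : ‖y‖ * sg ε y ≤ 1 := by
  have h1 := sg_sq he y
  have := sg_pos he y
  have h2 : (‖y‖ * sg ε y) ^ 2 ≤ 1 := by nlinarith [sq_nonneg (ε * sg ε y)]
  nlinarith [mul_nonneg (norm_nonneg y) this.le]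

lemma coord_mul_sg {ε : ℝ} (he : 0 < ε) (y : E3) (i : Fin 3) : |y i * sg ε y| ≤ 1 := by
  rw [abs_mul, abs_of_pos (sg_pos he y)]
  exact (mul_le_mul_of_nonneg_right (abs_coord y i) (sg_pos he y).le).trans (norm_mul_sg he y)

lemma sg_ld {ε : ℝ} (he : 0 < ε) (y : E3) (i : Fin 3) :
    HasLineDerivAt ℝ (sg ε) (-(y i) * sg ε y ^ 3) y (EuclideanSpace.single i 1) := by
  have hp : 0 < ‖y‖ ^ 2 + ε ^ 2 := by positivity
  have h1 : HasDerivAt (fun s : ℝ => (√(s + ε ^ 2))⁻¹) (-(1 / 2) * sg ε y ^ 3) (‖y‖ ^ 2) := by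
    have a := ((hasDerivAt_id (‖y‖ ^ 2)).add_const (ε ^ 2)).sqrt hp.ne'
    have b := a.fun_inv (by simp only [id]; positivity)
    simp only [id] at b
    refine b.congr_deriv ?_
    unfold sg
    field_simp
  have := ld_comp h1 (ld_w y (EuclideanSpace.single i 1))
  refine ld_congr this (fun y => rfl) ?_
  simp [EuclideanSpace.inner_single_right]
  ring


/-- Kronecker delta. -/
def kd (i j : Fin 3) : ℝ := if i = j then 1 else 0

/-- kernel -/
def K1 (ε : ℝ) (k : Fin 3) (y : E3) : ℝ := y k * sg ε y ^ 3
/-- first derivatives -/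
def K2 (ε : ℝ) (j k : Fin 3) (y : E3) : ℝ := kd j k * sg ε y ^ 3 - 3 * (y j * y k) * sg ε y ^ 5
/-- second derivatives -/
def K3 (ε : ℝ) (i j k : Fin 3) (y : E3) : ℝ :=
  -3 * (kd j k * y i + kd i j * y k + kd i k * y j) * sg ε y ^ 5 + 15 * (y i * y j * y k) * sg ε y ^ 7

lemma ld_pow {f : E3 → ℝ} {f' : ℝ} {x v : E3} (n : ℕ) (hf : HasLineDerivAt ℝ f f' x v) :
    HasLineDerivAt ℝ (fun y => f y ^ (n + 1)) ((n + 1) * f x ^ n * f') x v := by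
  have := ld_comp (hasDerivAt_pow (n + 1) (f x)) hf
  simpa using this


lemma kd_abs (i j : Fin 3) : |kd i j| ≤ 1 := by
  unfold kd; split <;> simp

lemma K1_ld {ε : ℝ} (he : 0 < ε) (j k : Fin 3) (y : E3) :
    HasLineDerivAt ℝ (K1 ε k) (K2 ε j k y) y (EuclideanSpace.single j 1) := by
  have h := ld_mul (ld_coord y (EuclideanSpace.single j 1) k) (ld_pow 2 (sg_ld he y j))
  refine ld_congr h (fun y => rfl) ?_
  unfold K2 kd
  simp only [PiLp.single_apply, eq_comm (a := j)]
  push_cast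
  ring

lemma K2_ld {ε : ℝ} (he : 0 < ε) (i j k : Fin 3) (y : E3) :
    HasLineDerivAt ℝ (K2 ε j k) (K3 ε i j k y) y (EuclideanSpace.single i 1) := by
  have h1 := ld_pow 2 (sg_ld he y i)
  have h2 := ld_pow 4 (sg_ld he y i)
  have h3 := ld_mul (ld_coord y (EuclideanSpace.single i 1) j) (ld_coord y (EuclideanSpace.single i 1) k)
  have c (c : ℝ) : HasLineDerivAt ℝ (fun _ : E3 => c) 0 y (EuclideanSpace.single i 1) := by
    unfold HasLineDerivAt; exact hasDerivAt_const _ _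
  have h := ld_add (ld_mul (c (kd j k)) h1) (ld_mul (ld_mul (c (-3)) h3) h2)
  refine ld_congr h (fun y => by unfold K2; ring) ?_
  unfold K3 kd
  simp only [PiLp.single_apply, eq_comm (a := i)]
  push_cast
  ring

lemma K1_cont {ε : ℝ} (he : 0 < ε) (k) : Continuous (K1 ε k) := by
  have := sg_cont he
  unfold K1; fun_prop
lemma K2_cont {ε : ℝ} (he : 0 < ε) (j k) : Continuous (K2 ε j k) := by
  have := sg_cont he
  unfold K2; fun_prop
lemma K3_cont {ε : ℝ} (he : 0 < ε) (i j k) : Continuous (K3 ε i j k) := by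
  have := sg_cont he
  unfold K3; fun_prop

lemma K1_b0 {ε : ℝ} (he : 0 < ε) (k y) : |K1 ε k y| ≤ sg ε y ^ 2 := by
  have s := sg_pos he y
  have : K1 ε k y = (y k * sg ε y) * sg ε y ^ 2 := by unfold K1; ring
  rw [this, abs_mul, abs_of_pos (pow_pos s 2)]
  have := coord_mul_sg he y k
  nlinarith [pow_pos s 2]

lemma K2_b0 {ε : ℝ} (he : 0 < ε) (j k y) : |K2 ε j k y| ≤ 4 * sg ε y ^ 3 := by
  have s := sg_pos he y
  have : K2 ε j k y = (kd j k - 3 * ((y j * sg ε y) * (y k * sg ε y))) * sg ε y ^ 3 := by unfold K2; ring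
  rw [this, abs_mul, abs_of_pos (pow_pos s 3)]
  gcongr
  refine (abs_sub _ _).trans ?_
  rw [abs_mul, abs_mul, abs_of_pos (by norm_num : (0:ℝ) < 3)]
  have := mul_le_mul (coord_mul_sg he y j) (coord_mul_sg he y k) (abs_nonneg _) zero_le_one
  linarith [kd_abs j k]

lemma K3_b0 {ε : ℝ} (he : 0 < ε) (i j k y) : |K3 ε i j k y| ≤ 24 * sg ε y ^ 4 := by
  have s := sg_pos he y
  obtain ⟨a, ha⟩ : ∃ a, a = y i * sg ε y := ⟨_, rfl⟩
  obtain ⟨b, hb⟩ : ∃ b, b = y j * sg ε y := ⟨_, rfl⟩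
  obtain ⟨c, hc⟩ : ∃ c, c = y k * sg ε y := ⟨_, rfl⟩
  have : K3 ε i j k y = (-3 * (kd j k * a + kd i j * c + kd i k * b) + 15 * (a * b * c)) * sg ε y ^ 4 := by
    subst ha hb hc; unfold K3; ring
  have h1 : |a| ≤ 1 := ha ▸ coord_mul_sg he y i
  have h2 : |b| ≤ 1 := hb ▸ coord_mul_sg he y j
  have h3 : |c| ≤ 1 := hc ▸ coord_mul_sg he y k
  rw [this, abs_mul, abs_of_pos (pow_pos s 4)]
  gcongr
  have P : ∀ p q : ℝ, |p| ≤ 1 → |q| ≤ 1 → |p * q| ≤ 1 := fun p q hp hq => by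
    rw [abs_mul]; exact mul_le_one₀ hp (abs_nonneg _) hq
  have e1 := abs_le.1 (P _ _ (kd_abs j k) h1)
  have e2 := abs_le.1 (P _ _ (kd_abs i j) h3)
  have e3 := abs_le.1 (P _ _ (kd_abs i k) h2)
  have e4 := abs_le.1 (P _ _ (P _ _ h1 h2) h3)
  rw [abs_le]; constructor <;> linarith [e1.1, e1.2, e2.1, e2.2, e3.1, e3.2, e4.1, e4.2]


/-- Combination of three scalar convolutions. -/
def comb (k : Fin 3 → E3 → ℝ) (h : E3 → Quaternion ℝ) (x : E3) : Quaternion ℝ :=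
  (1 / (4 * π)) • (qe 0 * cv (k 0) h x + qe 1 * cv (k 1) h x + qe 2 * cv (k 2) h x)

/-- The approximate identity. -/
def rho (ε : ℝ) (y : E3) : ℝ := (3 / (4 * π)) * (ε ^ 2 * sg ε y ^ 5)

section reg
variable {h : E3 → Quaternion ℝ}

lemma comb_bound (hc : Continuous h) (hs : HasCompactSupport h) {k : Fin 3 → E3 → ℝ}
    (hk : ∀ i, Continuous (k i)) {M : ℝ} {m : ℕ} (hM : ∀ i x, |k i x| ≤ M * jp x ^ m) :
    ∃ C, 0 ≤ C ∧ ∀ x, ‖comb k h x‖ ≤ C * jp x ^ m := by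
  choose C hC using fun i => cv_bound hc hs (hk i) (hM i)
  have C0 : ∀ i, 0 ≤ C i := fun i => 
    nonneg_of_mul_nonneg_left ((norm_nonneg _).trans (hC i 0)) (pow_pos (jp_pos 0) m)
  refine ⟨(1 / (4 * π)) * (C 0 + C 1 + C 2), ?_, fun x => ?_⟩
  · have := C0 0; have := C0 1; have := C0 2
    positivity
  unfold comb
  rw [norm_smul, Real.norm_eq_abs, abs_of_pos (by positivity), mul_assoc]
  gcongr
  refine (norm_add₃_le).trans ?_
  rw [norm_qe_mul, norm_qe_mul, norm_qe_mul]
  linarith [hC 0 x, hC 1 x, hC 2 x]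

lemma bnd_of_jp {k : E3 → ℝ} {M : ℝ} {m : ℕ} (hM : ∀ x, |k x| ≤ M * jp x ^ m) (x : E3) :
    |k x| ≤ M := by
  have M0 : 0 ≤ M := 
    nonneg_of_mul_nonneg_left ((abs_nonneg _).trans (hM 0)) (pow_pos (jp_pos 0) m)
  exact (hM x).trans (mul_le_of_le_one_right M0 (pow_le_one₀ (jp_pos x).le (jp_le_one x)))

lemma comb_cont (hc : Continuous h) (hs : HasCompactSupport h) {k : Fin 3 → E3 → ℝ}
    (hk : ∀ i, Continuous (k i)) {M : ℝ} {m : ℕ} (hM : ∀ i x, |k i x| ≤ M * jp x ^ m) :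
    Continuous (comb k h) := by
  have H := fun i => cv_cont hc hs (hk i) (bnd_of_jp (hM i))
  have := H 0; have := H 1; have := H 2
  unfold comb
  fun_prop

lemma comb_ld (hc : Continuous h) (hs : HasCompactSupport h) {k k' : Fin 3 → E3 → ℝ}
    (hk : ∀ i, Continuous (k i)) (hk' : ∀ i, Continuous (k' i))
    {M : ℝ} {m : ℕ} (hM : ∀ i x, |k' i x| ≤ M * jp x ^ m) {v : E3}
    (hd : ∀ i x, HasLineDerivAt ℝ (k i) (k' i x) x v) (x : E3) :
    HasLineDerivAt ℝ (comb k h) (comb k' h x) x v := by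
  have H := fun i => ld_qmul (qe i) (cv_ld hc hs (hk i) (hk' i) (bnd_of_jp (hM i)) (hd i) x)
  have := ld_add (ld_add (H 0) (H 1)) (H 2)
  unfold HasLineDerivAt at this ⊢
  exact this.const_smul (1 / (4 * π))

lemma rho_cont {ε : ℝ} (he : 0 < ε) : Continuous (rho ε) := by
  have := sg_cont he
  unfold rho; fun_prop

lemma K2_symm (ε : ℝ) (j k : Fin 3) : K2 ε j k = K2 ε k j := by
  funext y; unfold K2 kd; simp only [eq_comm (a := j)]; ring

lemma trace_K2 {ε : ℝ} (he : 0 < ε) (y : E3) :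
    K2 ε 0 0 y + K2 ε 1 1 y + K2 ε 2 2 y = (4 * π) * rho ε y := by
  have h1 := sg_sq he y
  rw [norm_sq_coord] at h1
  unfold K2 rho kd
  simp only [if_true]
  field_simp
  linear_combination (-3 * sg ε y ^ 3) * h1

lemma dirac_comb (hc : Continuous h) (hs : HasCompactSupport h) {ε : ℝ} (he : 0 < ε) (x : E3) :
    qe 0 * comb (K2 ε 0) h x + qe 1 * comb (K2 ε 1) h x + qe 2 * comb (K2 ε 2) h x =
      - cv (rho ε) h x := by
  have i := fun j => cv_int hc hs (K2_cont he j j) x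
  have i2 : Integrable (fun y => K2 ε 0 0 (x - y) • h y + K2 ε 1 1 (x - y) • h y) := (i 0).add (i 1)
  have t : cv (K2 ε 0 0) h x + cv (K2 ε 1 1) h x + cv (K2 ε 2 2) h x = (4 * π) • cv (rho ε) h x := by
    unfold cv
    rw [← integral_add (i 0) (i 1), ← integral_add i2 (i 2), ← integral_smul]
    congr 1; funext y
    rw [← add_smul, ← add_smul, trace_K2 he, mul_smul]
  have t2 : cv (rho ε) h x = (1 / (4 * π)) • (cv (K2 ε 0 0) h x + cv (K2 ε 1 1) h x + cv (K2 ε 2 2) h x) := by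
    rw [t, smul_smul, one_div_mul_cancel (by positivity), one_smul]
  rw [t2]
  unfold comb
  rw [K2_symm ε 1 0, K2_symm ε 2 0, K2_symm ε 2 1]
  generalize cv (K2 ε 0 0) h x = a
  generalize cv (K2 ε 0 1) h x = b
  generalize cv (K2 ε 0 2) h x = c
  generalize cv (K2 ε 1 1) h x = d
  generalize cv (K2 ε 1 2) h x = e
  generalize cv (K2 ε 2 2) h x = f
  simp only [mul_smul_comm, ← smul_add, ← smul_neg]
  congr 1
  ext <;> simp only [mul_add, Quaternion.re_add, Quaternion.imI_add, Quaternion.imJ_add, Quaternion.imK_add,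
    Quaternion.re_neg, Quaternion.imI_neg, Quaternion.imJ_neg, Quaternion.imK_neg,
    qe0_mul_re, qe0_mul_imI, qe0_mul_imJ, qe0_mul_imK, qe1_mul_re, qe1_mul_imI, qe1_mul_imJ,
    qe1_mul_imK, qe2_mul_re, qe2_mul_imI, qe2_mul_imJ, qe2_mul_imK] <;> ring

lemma reg_ineq (hc : Continuous h) (hs : HasCompactSupport h) {ε : ℝ} (he : 0 < ε) (he1 : ε ≤ 1) :
    9 * ∫ x, ‖comb (K1 ε) h x‖ ^ 2 / (1 + ‖x‖ ^ 2) ≤ ∫ x, ‖cv (rho ε) h x‖ ^ 2 * (1 + ‖x‖ ^ 2) := by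
  have sb : ∀ (m : ℕ) y, sg ε y ^ m ≤ (ε⁻¹) ^ m * jp y ^ m := fun m y => by
    rw [← mul_pow]; exact pow_le_pow_left₀ (sg_pos he y).le (sg_le he he1 y) m
  have b1 : ∀ k y, |K1 ε k y| ≤ (ε⁻¹) ^ 2 * jp y ^ 2 := fun k y => (K1_b0 he k y).trans (sb 2 y)
  have b2 : ∀ j k y, |K2 ε j k y| ≤ (4 * (ε⁻¹) ^ 3) * jp y ^ 3 := fun j k y =>
    (K2_b0 he j k y).trans (by linarith [sb 3 y])
  have b3 : ∀ i j k y, |K3 ε i j k y| ≤ (24 * (ε⁻¹) ^ 4) * jp y ^ 4 := fun i j k y =>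
    (K3_b0 he i j k y).trans (by linarith [sb 4 y])
  obtain ⟨C1, p1, h1⟩ := comb_bound hc hs (K1_cont he) b1
  choose C2 p2 h2 using fun i => comb_bound hc hs (K2_cont he i) (b2 i)
  choose C3 p3 h3 using fun i j => comb_bound hc hs (K3_cont he i j) (b3 i j)
  have q2 : ∀ i, C2 i ≤ ∑ i, C2 i := fun i => Finset.single_le_sum (fun i _ => p2 i) (Finset.mem_univ i)
  have q3 : ∀ i j, C3 i j ≤ ∑ i, ∑ j, C3 i j := fun i j =>
    (Finset.single_le_sum (f := C3 i) (fun j _ => p3 i j) (Finset.mem_univ j)).trans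
    (Finset.single_le_sum (f := fun i => ∑ j, C3 i j) (fun i _ => Finset.sum_nonneg fun j _ => p3 i j) (Finset.mem_univ i))
  have r2 : 0 ≤ ∑ i, C2 i := Finset.sum_nonneg fun i _ => p2 i
  have r3 : 0 ≤ ∑ i, ∑ j, C3 i j := Finset.sum_nonneg fun i _ => Finset.sum_nonneg fun j _ => p3 i j
  have := core (comb (K1 ε) h) (fun i => comb (K2 ε i) h) (fun i j => comb (K3 ε i j) h)
    (C1 + ∑ i, C2 i + ∑ i, ∑ j, C3 i j)
    (comb_cont hc hs (K1_cont he) b1) (fun i => comb_cont hc hs (K2_cont he i) (b2 i))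
    (fun i j => comb_cont hc hs (K3_cont he i j) (b3 i j))
    (fun i => comb_ld hc hs (K1_cont he) (K2_cont he i) (b2 i) (fun k => K1_ld he i k))
    (fun i j => comb_ld hc hs (K2_cont he j) (K3_cont he i j) (b3 i j) (fun k => K2_ld he i j k))
    (fun i j x => by
      have : K3 ε i j = K3 ε j i := by
        funext k y; unfold K3 kd; simp only [eq_comm (a := i) (b := j)]; ring
      simp only [this])
    (fun x => (h1 x).trans (mul_le_mul_of_nonneg_right (by linarith) (pow_nonneg (jp_pos x).le _)))
    (fun i x => (h2 i x).trans (mul_le_mul_of_nonneg_right (by linarith [q2 i]) (pow_nonneg (jp_pos x).le _)))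
    (fun i j x => (h3 i j x).trans (mul_le_mul_of_nonneg_right (by linarith [q3 i j]) (pow_nonneg (jp_pos x).le _)))
  refine this.trans (le_of_eq ?_)
  congr 1; funext x
  rw [dirac_comb hc hs he, norm_neg]
end reg

lemma sg_scale {ε : ℝ} (he : 0 < ε) (z : E3) : sg ε z = ε⁻¹ * sg 1 (ε⁻¹ • z) := by
  unfold sg
  rw [← mul_inv, norm_smul, Real.norm_eq_abs, abs_of_pos (inv_pos.2 he)]
  congr 1
  have e : ‖z‖ ^ 2 + ε ^ 2 = ε ^ 2 * ((ε⁻¹ * ‖z‖) ^ 2 + 1 ^ 2) := by field_simp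
  rw [e, Real.sqrt_mul (by positivity), Real.sqrt_sq he.le]

lemma rho_scale {ε : ℝ} (he : 0 < ε) (z : E3) : rho ε z = (ε⁻¹) ^ 3 * rho 1 (ε⁻¹ • z) := by
  unfold rho
  rw [sg_scale he]
  field_simp

lemma rad_int : ∫ y in Set.Ioi (0:ℝ), y ^ 2 * (3 * ((√(y ^ 2 + 1 ^ 2))⁻¹) ^ 5) = 1 := by
  have hd : ∀ x ∈ Set.Ici (0:ℝ), HasDerivAt (fun r : ℝ => r ^ 3 * ((√(r ^ 2 + 1 ^ 2))⁻¹) ^ 3)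
      (x ^ 2 * (3 * ((√(x ^ 2 + 1 ^ 2))⁻¹) ^ 5)) x := by
    intro x _
    have hp : 0 < x ^ 2 + 1 ^ 2 := by positivity
    have a := (((hasDerivAt_pow 2 x).add_const (1 ^ 2)).sqrt hp.ne').fun_inv (by positivity)
    have b := (hasDerivAt_pow 3 x).mul (a.fun_pow 3)
    refine b.congr_deriv ?_
    have s := Real.sq_sqrt hp.le
    have sp : 0 < √(x ^ 2 + 1 ^ 2) := by positivity
    generalize √(x ^ 2 + 1 ^ 2) = t at *
    push_cast
    simp only [Nat.add_one_sub_one, pow_one]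
    field_simp
    linear_combination (x ^ 2) * s
  have lim : Tendsto (fun r : ℝ => r ^ 3 * ((√(r ^ 2 + 1 ^ 2))⁻¹) ^ 3) atTop (𝓝 1) := by
    have h1 : Tendsto (fun r : ℝ => ((√(1 + (r⁻¹) ^ 2))⁻¹) ^ 3) atTop (𝓝 1) := by
      have : ContinuousAt (fun s : ℝ => ((√(1 + s ^ 2))⁻¹) ^ 3) 0 := by
        refine ContinuousAt.pow (ContinuousAt.inv₀ (by fun_prop) (by positivity)) 3
      have := this.tendsto.comp tendsto_inv_atTop_zero
      simpa [Function.comp_def] using this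
    refine h1.congr' ?_
    filter_upwards [eventually_gt_atTop 0] with r hr
    rw [← mul_pow]
    congr 1
    have : √(r ^ 2 + 1 ^ 2) = r * √(1 + (r⁻¹) ^ 2) := by
      rw [show r ^ 2 + 1 ^ 2 = r ^ 2 * (1 + (r⁻¹) ^ 2) by field_simp, Real.sqrt_mul (by positivity),
        Real.sqrt_sq hr.le]
    rw [this, mul_inv, ← mul_assoc, mul_inv_cancel₀ hr.ne', one_mul]
  have := integral_Ioi_of_hasDerivAt_of_nonneg' hd (fun x _ => by positivity) lim
  simpa using this

lemma rho_one : ∫ y, rho 1 y = 1 := by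
  have := integral_fun_norm_addHaar (volume : Measure E3)
    (fun r : ℝ => (3 / (4 * π)) * (1 ^ 2 * ((√(r ^ 2 + 1 ^ 2))⁻¹) ^ 5))
  have e : (∫ y, rho 1 y) = ∫ y : E3, (3 / (4 * π)) * (1 ^ 2 * ((√(‖y‖ ^ 2 + 1 ^ 2))⁻¹) ^ 5) := rfl
  rw [e, this]
  have v : (volume : Measure E3).real (Metric.ball 0 1) = π * 4 / 3 := by
    rw [Measure.real, EuclideanSpace.volume_ball_fin_three]
    simp
    positivity
  rw [v, finrank_euclideanSpace_fin]
  have r : ∫ y in Set.Ioi (0:ℝ), y ^ (3 - 1) • ((3 / (4 * π)) * (1 ^ 2 * ((√(y ^ 2 + 1 ^ 2))⁻¹) ^ 5)) = 1 / (4 * π) := by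
    have := integral_const_mul (μ := volume.restrict (Set.Ioi (0:ℝ))) (1 / (4 * π))
      (fun y : ℝ => y ^ 2 * (3 * ((√(y ^ 2 + 1 ^ 2))⁻¹) ^ 5))
    rw [rad_int, mul_one] at this
    rw [← this]
    congr 1; funext y
    simp only [smul_eq_mul]
    ring
  rw [r]
  simp only [nsmul_eq_mul, smul_eq_mul]
  have := Real.pi_ne_zero
  field_simp
  norm_num

lemma rho_int {ε : ℝ} (he : 0 < ε) : ∫ y, rho ε y = 1 := by
  simp_rw [rho_scale he]
  rw [integral_const_mul, Measure.integral_comp_smul, rho_one, finrank_euclideanSpace_fin,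
    abs_of_pos (by positivity)]
  simp only [smul_eq_mul]
  field_simp

lemma rho_nonneg {ε : ℝ} (he : 0 < ε) (y : E3) : 0 ≤ rho ε y := by
  have := sg_pos he y
  unfold rho; positivity

lemma rho_dec {ε : ℝ} (he : 0 < ε) (y : E3) : ‖y‖ ^ 3 * rho ε y ≤ (3 / (4 * π)) * (ε * sg ε y) ^ 2 := by
  have h1 := norm_mul_sg he y
  have h2 := sg_pos he y
  have : ‖y‖ ^ 3 * rho ε y = (3 / (4 * π)) * (ε * sg ε y) ^ 2 * (‖y‖ * sg ε y) ^ 3 := by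
    unfold rho; ring
  rw [this]
  exact mul_le_of_le_one_right (by positivity) (pow_le_one₀ (by positivity) h1)

lemma rho_dec' {ε : ℝ} (he : 0 < ε) (y : E3) : ‖y‖ ^ 3 * rho ε y ≤ 3 / (4 * π) := by
  refine (rho_dec he y).trans (mul_le_of_le_one_right (by positivity) ?_)
  have := sg_sq he y
  have h2 := sg_pos he y
  nlinarith [sq_nonneg (‖y‖ * sg ε y)]

section lim
variable {h : E3 → Quaternion ℝ}

lemma cv_rho_tendsto (hc : Continuous h) (hs : HasCompactSupport h) (x : E3) :
    Tendsto (fun n : ℕ => cv (rho ((n : ℝ) + 1)⁻¹) h x) atTop (𝓝 (h x)) := by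
  have := tendsto_integral_comp_smul_smul_of_integrable' (μ := (volume : Measure E3)) (φ := rho 1)
    (rho_nonneg one_pos) rho_one ?_ (hc.integrable_of_hasCompactSupport hs) (hc.continuousAt (x := x))
  · have t : Tendsto (fun n : ℕ => (n : ℝ) + 1) atTop atTop :=
      tendsto_atTop_add_const_right _ _ tendsto_natCast_atTop_atTop
    refine (this.comp t).congr fun n => ?_
    simp only [Function.comp, cv]
    congr 1; funext y
    rw [rho_scale (by positivity) (x - y), inv_inv, finrank_euclideanSpace_fin]
  · rw [finrank_euclideanSpace_fin]
    refine squeeze_zero (fun y => mul_nonneg (by positivity) (rho_nonneg one_pos y)) (rho_dec one_pos) ?_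
    have s : Tendsto (fun y : E3 => sg 1 y) (Bornology.cobounded E3) (𝓝 0) := by
      refine squeeze_zero' (Eventually.of_forall fun y => (sg_pos one_pos y).le) (g := fun y => ‖y‖⁻¹) ?_
        (tendsto_inv_atTop_zero.comp tendsto_norm_cobounded_atTop)
      have := (tendsto_norm_cobounded_atTop (E := E3)).eventually_gt_atTop 0
      filter_upwards [this] with y hy
      have := norm_mul_sg one_pos y
      rw [← one_div, le_div_iff₀ hy, mul_comm]; exact this
    have := ((s.const_mul 1).pow 2).const_mul (3 / (4 * π))
    simpa using this

lemma cv_rho_bound (hc : Continuous h) (hs : HasCompactSupport h) :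
    ∃ C, ∀ ε, 0 < ε → ∀ x, ‖cv (rho ε) h x‖ ≤ C * jp x ^ 3 := by
  have hc1 : Continuous fun y : E3 => (1 + 4 * ‖y‖ ^ 3) * ‖h y‖ := by fun_prop
  obtain ⟨H, hH⟩ := hc1.bounded_above_of_compact_support (hs.norm.mul_left)
  have hH' : ∀ y, (1 + 4 * ‖y‖ ^ 3) * ‖h y‖ ≤ H := fun y => (le_abs_self _).trans (hH y)
  refine ⟨4 * (H + (3 / π) * ∫ y, ‖h y‖), fun ε he x => ?_⟩
  have ih := (hc.integrable_of_hasCompactSupport hs).norm (μ := volume)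
  have ir : Integrable (fun y => rho ε (x - y)) :=
    (integrable_of_integral_eq_one (rho_int he)).comp_sub_left x
  have jr : ∫ y, rho ε (x - y) = 1 := by rw [integral_sub_left_eq_self (rho ε), rho_int he]
  have key : (1 + ‖x‖ ^ 3) * ‖cv (rho ε) h x‖ ≤ H + (3 / π) * ∫ y, ‖h y‖ := by
    have : (1 + ‖x‖ ^ 3) * ‖cv (rho ε) h x‖ = ‖∫ y, (1 + ‖x‖ ^ 3) • (rho ε (x - y) • h y)‖ := by
      rw [integral_smul, norm_smul, Real.norm_eq_abs, abs_of_pos (by positivity)]; rfl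
    rw [this]
    have e : H + (3 / π) * ∫ y, ‖h y‖ = ∫ y, (rho ε (x - y) * H + (3 / π) * ‖h y‖) := by
      rw [integral_add (ir.mul_const H) (ih.const_mul _), integral_mul_const, integral_const_mul, jr, one_mul]
    rw [e]
    refine norm_integral_le_of_norm_le ((ir.mul_const H).add (ih.const_mul _)) (Eventually.of_forall fun y => ?_)
    rw [norm_smul, norm_smul, Real.norm_eq_abs, Real.norm_eq_abs, abs_of_pos (by positivity),
      abs_of_nonneg (rho_nonneg he _)]
    have r0 := rho_nonneg he (x - y)
    have t : ‖x‖ ≤ ‖y‖ + ‖x - y‖ := by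
      simpa using norm_add_le y (x - y)
    have t3 : ‖x‖ ^ 3 ≤ 4 * (‖y‖ ^ 3 + ‖x - y‖ ^ 3) := by
      refine (pow_le_pow_left₀ (norm_nonneg x) t 3).trans ?_
      have := add_pow_le (norm_nonneg y) (norm_nonneg (x - y)) 3
      norm_num at this; exact this
    have d := rho_dec' he (x - y)
    have d4 : 4 * (3 / (4 * π)) = 3 / π := by field_simp
    calc _ ≤ (1 + 4 * (‖y‖ ^ 3 + ‖x - y‖ ^ 3)) * (rho ε (x - y) * ‖h y‖) := by gcongr
      _ = rho ε (x - y) * ((1 + 4 * ‖y‖ ^ 3) * ‖h y‖) + 4 * (‖x - y‖ ^ 3 * rho ε (x - y)) * ‖h y‖ := by ring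
      _ ≤ rho ε (x - y) * H + 4 * (3 / (4 * π)) * ‖h y‖ := by gcongr; exact hH' y
      _ = _ := by rw [d4]
  have j0 := jp_pos x
  have n0 := norm_nonneg x
  have j1 : 1 ≤ (1 + ‖x‖) * jp x := by
    have := w_jp x
    have : 1 ≤ ((1 + ‖x‖) * jp x) ^ 2 := by nlinarith [mul_nonneg n0 (pow_pos j0 2).le]
    by_contra hh
    push Not at hh
    have : ((1 + ‖x‖) * jp x) ^ 2 < 1 := pow_lt_one₀ (by positivity) hh two_ne_zero
    linarith
  have j3 : 1 ≤ 4 * (1 + ‖x‖ ^ 3) * jp x ^ 3 := by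
    calc (1:ℝ) ≤ ((1 + ‖x‖) * jp x) ^ 3 := one_le_pow₀ j1
      _ = (1 + ‖x‖) ^ 3 * jp x ^ 3 := by ring
      _ ≤ _ := by
        gcongr
        nlinarith [mul_nonneg (by linarith : 0 ≤ ‖x‖ + 1) (sq_nonneg (‖x‖ - 1))]
  calc ‖cv (rho ε) h x‖ ≤ ‖cv (rho ε) h x‖ * (4 * (1 + ‖x‖ ^ 3) * jp x ^ 3) :=
        le_mul_of_one_le_right (norm_nonneg _) j3
    _ = 4 * ((1 + ‖x‖ ^ 3) * ‖cv (rho ε) h x‖) * jp x ^ 3 := by ring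
    _ ≤ _ := by gcongr

lemma rhs_tendsto (hc : Continuous h) (hs : HasCompactSupport h) :
    Tendsto (fun n : ℕ => ∫ x, ‖cv (rho ((n : ℝ) + 1)⁻¹) h x‖ ^ 2 * (1 + ‖x‖ ^ 2)) atTop
      (𝓝 (∫ x, ‖h x‖ ^ 2 * (1 + ‖x‖ ^ 2))) := by
  obtain ⟨C, hC⟩ := cv_rho_bound hc hs
  have hn : ∀ n : ℕ, 0 < ((n : ℝ) + 1)⁻¹ := fun n => by positivity
  refine tendsto_integral_of_dominated_convergence (fun x => C ^ 2 * jp x ^ 4) (fun n => ?_)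
    (integrable_jp_four.const_mul _) (fun n => Eventually.of_forall fun x => ?_)
    (Eventually.of_forall fun x => ?_)
  · have he := hn n
    have : Continuous (cv (rho ((n : ℝ) + 1)⁻¹) h) := by
      refine cv_cont hc hs (rho_cont he) (M := 3 / (4 * π) * ((((n : ℝ) + 1)⁻¹) ^ 2 * (((((n : ℝ) + 1)⁻¹)⁻¹) ^ 5))) fun x => ?_
      rw [abs_of_nonneg (rho_nonneg he x)]
      unfold rho
      gcongr
      · exact (sg_pos he x).le
      · have h1 := sg_pos he x
        have h2 := sg_sq he x
        have : (sg ((n : ℝ) + 1)⁻¹ x * ((n : ℝ) + 1)⁻¹) ^ 2 ≤ 1 := by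
          nlinarith [sq_nonneg (‖x‖ * sg ((n : ℝ) + 1)⁻¹ x)]
        have q := (le_div_iff₀ he).2 ((sq_le_one_iff₀ (by positivity)).1 this)
        exact q.trans (one_div _).le
    exact Continuous.aestronglyMeasurable (by fun_prop)
  · have e := w_jp x
    rw [Real.norm_eq_abs, abs_of_nonneg (by positivity)]
    calc _ ≤ (C * jp x ^ 3) ^ 2 * (1 + ‖x‖ ^ 2) := by gcongr; exact hC _ (hn n) x
      _ = _ := by linear_combination (C * jp x ^ 2) ^ 2 * e
  · exact ((cv_rho_tendsto hc hs x).norm.pow 2).mul_const _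
end lim

lemma quat_eq (v : E3) : quatOfR3 v = v 0 • qe 0 + v 1 • qe 1 + v 2 • qe 2 := by
  ext <;> simp only [Quaternion.re_add, Quaternion.imI_add, Quaternion.imJ_add, Quaternion.imK_add,
    Quaternion.re_smul, Quaternion.imI_smul, Quaternion.imJ_smul, Quaternion.imK_smul] <;>
    simp [quatOfR3, qe]

lemma quat_cont : Continuous quatOfR3 := by
  rw [show quatOfR3 = fun v => v 0 • qe 0 + v 1 • qe 1 + v 2 • qe 2 from funext quat_eq]
  fun_prop

lemma quat_norm (v : E3) : ‖quatOfR3 v‖ = ‖v‖ := by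
  have : ‖quatOfR3 v‖ ^ 2 = ‖v‖ ^ 2 := by
    rw [← real_inner_self_eq_norm_sq, qinner, norm_sq_coord]
    simp [quatOfR3]
    ring
  exact (sq_eq_sq₀ (norm_nonneg _) (norm_nonneg _)).1 this

section fin
variable {h : E3 → Quaternion ℝ}

lemma qe_cv (hc : Continuous h) (hs : HasCompactSupport h) {ε : ℝ} (he : 0 < ε) (x : E3) (k : Fin 3) :
    Integrable (fun y => qe k * (K1 ε k (x - y) • h y)) ∧
    qe k * cv (K1 ε k) h x = ∫ y, qe k * (K1 ε k (x - y) • h y) := by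
  have i := cv_int hc hs (K1_cont he k) x
  have e := (ContinuousLinearMap.mul ℝ (Quaternion ℝ) (qe k)).integral_comp_comm i
  have e2 := (ContinuousLinearMap.mul ℝ (Quaternion ℝ) (qe k)).integrable_comp i
  simp only [ContinuousLinearMap.mul_apply'] at e e2
  exact ⟨e2, e.symm⟩

lemma comb_eq (hc : Continuous h) (hs : HasCompactSupport h) {ε : ℝ} (he : 0 < ε) (x : E3) :
    comb (K1 ε) h x = (1 / (4 * π)) • ∫ y, sg ε (x - y) ^ 3 • (quatOfR3 (x - y) * h y) := by
  have H := qe_cv hc hs he x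
  unfold comb
  rw [(H 0).2, (H 1).2, (H 2).2]
  have i2 : Integrable (fun y => qe 0 * (K1 ε 0 (x - y) • h y) + qe 1 * (K1 ε 1 (x - y) • h y)) :=
    (H 0).1.add (H 1).1
  rw [← integral_add (H 0).1 (H 1).1, ← integral_add i2 (H 2).1]
  congr 2; funext y
  rw [quat_eq]
  unfold K1
  simp only [add_mul, mul_smul_comm, smul_mul_assoc, smul_add, smul_smul, mul_comm]

lemma dom_int (hc : Continuous h) (hs : HasCompactSupport h) (x : E3) :
    Integrable (fun y => (‖x - y‖ ^ 2)⁻¹ * ‖h y‖) := by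
  have l : LocallyIntegrable (fun z : E3 => (‖z‖ ^ 2)⁻¹) := by
    refine locallyIntegrable_of_norm_le_rpow (C := 1) (α := 2) (by rw [finrank_euclideanSpace_fin]; norm_num)
      (by rw [finrank_euclideanSpace_fin]; norm_num) (Eventually.of_forall fun z => ?_)
      (by fun_prop)
    rw [Real.norm_eq_abs, abs_of_nonneg (by positivity), one_mul, Real.rpow_neg (norm_nonneg z)]
    norm_cast
  have cs : HasCompactSupport (fun z => ‖h (x - z)‖) :=
    (hs.comp_homeomorph (Homeomorph.subLeft x)).norm
  have := (l.integrable_smul_right_of_hasCompactSupport (g := fun z => ‖h (x - z)‖) (by fun_prop) cs).comp_sub_left x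
  simpa [mul_comm] using this

lemma u_tendsto (hc : Continuous h) (hs : HasCompactSupport h) (x : E3) :
    Tendsto (fun n : ℕ => comb (K1 ((n : ℝ) + 1)⁻¹) h x) atTop
      (𝓝 ((1 / (4 * π)) • ∫ y, (‖x - y‖ ^ 3)⁻¹ • (quatOfR3 (x - y) * h y))) := by
  have hn : ∀ n : ℕ, 0 < ((n : ℝ) + 1)⁻¹ := fun n => by positivity
  simp_rw [fun n : ℕ => comb_eq hc hs (hn n) x]
  refine Tendsto.const_smul ?_ _
  refine tendsto_integral_of_dominated_convergence (fun y => (‖x - y‖ ^ 2)⁻¹ * ‖h y‖) (fun n => ?_)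
    (dom_int hc hs x) (fun n => Eventually.of_forall fun y => ?_) (Eventually.of_forall fun y => ?_)
  · have := sg_cont (hn n)
    have := quat_cont
    exact Continuous.aestronglyMeasurable (by fun_prop)
  · have s0 := sg_pos (hn n) (x - y)
    have s1 := norm_mul_sg (hn n) (x - y)
    rw [norm_smul, norm_mul, quat_norm, Real.norm_eq_abs, abs_of_pos (pow_pos s0 3), ← mul_assoc]
    gcongr
    rcases eq_or_lt_of_le (norm_nonneg (x - y)) with h0 | h0
    · rw [← h0]; simp
    · refine le_trans ((le_div_iff₀ (by positivity)).2 ?_) (one_div (‖x - y‖ ^ 2)).le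
      calc _ = (‖x - y‖ * sg ((n : ℝ) + 1)⁻¹ (x - y)) ^ 3 := by ring
        _ ≤ 1 := pow_le_one₀ (by positivity) s1
  · by_cases hz : x - y = 0
    · rw [hz]
      have : quatOfR3 0 = 0 := by rw [quat_eq]; simp
      simp [this]
    · refine Tendsto.smul_const ?_ _
      have p : 0 < ‖x - y‖ := norm_pos_iff.2 hz
      have c : ContinuousAt (fun ε : ℝ => (√(‖x - y‖ ^ 2 + ε ^ 2))⁻¹ ^ 3) 0 :=
        ContinuousAt.pow (ContinuousAt.inv₀ (by fun_prop) (by positivity)) 3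
      have t : Tendsto (fun n : ℕ => ((n : ℝ) + 1)⁻¹) atTop (𝓝 0) := by
        simpa using tendsto_one_div_add_atTop_nhds_zero_nat (𝕜 := ℝ)
      have := c.tendsto.comp t
      simpa [Function.comp_def, sg, Real.sqrt_sq p.le] using this

lemma comb_sq_int (hc : Continuous h) (hs : HasCompactSupport h) {ε : ℝ} (he : 0 < ε) (he1 : ε ≤ 1) :
    Continuous (fun x => ‖comb (K1 ε) h x‖ ^ 2 / (1 + ‖x‖ ^ 2)) ∧
    Integrable (fun x => ‖comb (K1 ε) h x‖ ^ 2 / (1 + ‖x‖ ^ 2)) := by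
  have b1 : ∀ k y, |K1 ε k y| ≤ (ε⁻¹) ^ 2 * jp y ^ 2 := fun k y => (K1_b0 he k y).trans (by
    rw [← mul_pow]; exact pow_le_pow_left₀ (sg_pos he y).le (sg_le he he1 y) 2)
  obtain ⟨C, C0, bu⟩ := comb_bound hc hs (K1_cont he) b1
  have cu := comb_cont hc hs (K1_cont he) b1
  have cq : Continuous (fun x => ‖comb (K1 ε) h x‖ ^ 2 / (1 + ‖x‖ ^ 2)) :=
    Continuous.div (by fun_prop) (by fun_prop) fun x => by positivity
  refine ⟨cq, integrable_of_jp (C := C ^ 2) cq fun x => ?_⟩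
  rw [Real.norm_eq_abs, abs_of_nonneg (by positivity), div_eq_mul_inv, ← jp_sq]
  calc _ ≤ (C * jp x ^ 2) ^ 2 * 1 := by
        gcongr
        · exact bu x
        · exact pow_le_one₀ (jp_pos x).le (jp_le_one x)
    _ = _ := by ring

lemma main_sq (hc : Continuous h) (hs : HasCompactSupport h) (u : E3 → Quaternion ℝ)
    (hu : ∀ x, u x = (1 / (4 * π)) • ∫ y, (‖x - y‖ ^ 3)⁻¹ • (quatOfR3 (x - y) * h y)) :
    ∫ x, ‖u x‖ ^ 2 / (1 + ‖x‖ ^ 2) ≤ (1 / 9) * ∫ x, ‖h x‖ ^ 2 * (1 + ‖x‖ ^ 2) := by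
  have hn : ∀ n : ℕ, 0 < ((n : ℝ) + 1)⁻¹ := fun n => by positivity
  have hn1 : ∀ n : ℕ, ((n : ℝ) + 1)⁻¹ ≤ 1 := fun n => inv_le_one_of_one_le₀ (by
    have : (0:ℝ) ≤ n := Nat.cast_nonneg n
    linarith)
  set f : ℕ → E3 → ℝ := fun n x => ‖comb (K1 ((n : ℝ) + 1)⁻¹) h x‖ ^ 2 / (1 + ‖x‖ ^ 2) with hf
  have cf : ∀ n, Continuous (f n) := fun n => (comb_sq_int hc hs (hn n) (hn1 n)).1
  have jf : ∀ n, Integrable (f n) := fun n => (comb_sq_int hc hs (hn n) (hn1 n)).2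
  have f0 : ∀ n x, 0 ≤ f n x := fun n x => by simp only [hf]; positivity
  have tf : ∀ x, Tendsto (fun n => f n x) atTop (𝓝 (‖u x‖ ^ 2 / (1 + ‖x‖ ^ 2))) := fun x => by
    rw [hu x]
    exact ((u_tendsto hc hs x).norm.pow 2).div_const _
  have mu : AEStronglyMeasurable (fun x => ‖u x‖ ^ 2 / (1 + ‖x‖ ^ 2)) volume :=
    aestronglyMeasurable_of_tendsto_ae atTop (fun n => (cf n).aestronglyMeasurable) (Eventually.of_forall tf)
  have B0 : 0 ≤ ∫ x, ‖h x‖ ^ 2 * (1 + ‖x‖ ^ 2) := integral_nonneg fun x => by positivity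
  rw [integral_eq_lintegral_of_nonneg_ae (Eventually.of_forall fun x => by positivity) mu]
  refine ENNReal.toReal_le_of_le_ofReal (by positivity) ?_
  have fatou := lintegral_liminf_le (u := atTop) (μ := (volume : Measure E3)) (f := fun n x => ENNReal.ofReal (f n x))
    (fun n => (cf n).measurable.ennreal_ofReal)
  have e1 : ∀ x, liminf (fun n => ENNReal.ofReal (f n x)) atTop = ENNReal.ofReal (‖u x‖ ^ 2 / (1 + ‖x‖ ^ 2)) :=
    fun x => (ENNReal.tendsto_ofReal (tf x)).liminf_eq
  simp only [e1] at fatou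
  refine fatou.trans ?_
  have tb : Tendsto (fun n : ℕ => ENNReal.ofReal ((1 / 9) * ∫ x, ‖cv (rho ((n : ℝ) + 1)⁻¹) h x‖ ^ 2 * (1 + ‖x‖ ^ 2)))
      atTop (𝓝 (ENNReal.ofReal ((1 / 9) * ∫ x, ‖h x‖ ^ 2 * (1 + ‖x‖ ^ 2)))) :=
    (ENNReal.continuous_ofReal.tendsto _).comp ((rhs_tendsto hc hs).const_mul _)
  rw [← tb.liminf_eq]
  refine liminf_le_liminf (Eventually.of_forall fun n => ?_)
  rw [← ofReal_integral_eq_lintegral_ofReal (jf n) (Eventually.of_forall (f0 n))]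
  refine ENNReal.ofReal_le_ofReal ?_
  have := reg_ineq hc hs (hn n) (hn1 n)
  linarith
end fin

/-- The sharp weighted bound for convolution with the Cauchy kernel
`G₁(x) = x/(ω₃‖x‖³)` in `ℝ³` (`ω₃ = 4π`): for `h : ℝ³ → ℍ` continuous with compact
support and `u(x) = (1/(4π)) ∫ (q(x-y)/‖x-y‖³) h(y) dy`,
`(∫ ‖u‖²/(1+‖x‖²) dx)^{1/2} ≤ (1/3) (∫ ‖h‖²(1+‖x‖²) dx)^{1/2}`. -/
theorem weighted_cauchy_transform_bound_R3
    (h : EuclideanSpace ℝ (Fin 3) → Quaternion ℝ)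
    (hcont : Continuous h) (hsupp : HasCompactSupport h)
    (u : EuclideanSpace ℝ (Fin 3) → Quaternion ℝ)
    (hu : ∀ x, u x = (1 / (4 * π)) •
      ∫ y, (‖x - y‖ ^ 3)⁻¹ • (quatOfR3 (x - y) * h y)) :
    Real.sqrt (∫ x, ‖u x‖ ^ 2 / (1 + ‖x‖ ^ 2)) ≤
      (1 / 3) * Real.sqrt (∫ x, ‖h x‖ ^ 2 * (1 + ‖x‖ ^ 2)) := by
  have h1 := main_sq hcont hsupp u hu
  have h2 : (1 / 3 : ℝ) * Real.sqrt (∫ x, ‖h x‖ ^ 2 * (1 + ‖x‖ ^ 2)) =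
      Real.sqrt ((1 / 9) * ∫ x, ‖h x‖ ^ 2 * (1 + ‖x‖ ^ 2)) := by
    rw [Real.sqrt_mul (by norm_num), show (1 / 9 : ℝ) = (1 / 3) ^ 2 by norm_num,
      Real.sqrt_sq (by norm_num)]
  rw [h2]
  exact Real.sqrt_le_sqrt h1

end
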